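/- For every n ≥ 1: δ_n ≤ ε_p |V| R_max [ φ^(n−1) + (1/(1−φ)) (1 + 3φ|O|/(1−φ)) ]. In particular, the incurred error of the optimal value function computed with the predicted strategy is linearly bounded by the prediction error ε_p. -/

import Mathlib

open Finset

noncomputable section

variable {S U V O : Type*}

/-- `b : S → ℝ` is a belief (probability distribution over states). -/
def IsBelief [Fintype S] (b : S → ℝ) : Prop :=
  (∀ s, 0 ≤ b s) ∧ ∑ s, b s = 1

/-- `P : S → V → ℝ` is a (mixed) strategy of the other agent. -/
def IsStrategy [Fintype V] (P : S → V → ℝ) : Prop :=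
  (∀ s v, 0 ≤ P s v) ∧ ∀ s, ∑ v, P s v = 1

/-- Expected immediate payoff `R_P(b,u) = Σ_{s,v} b(s) P(s,v) R(s,u,v)`. -/
def expR [Fintype S] [Fintype V] (R : S → U → V → ℝ) (P : S → V → ℝ)
    (b : S → ℝ) (u : U) : ℝ :=
  ∑ s, ∑ v, b s * P s v * R s u v

/-- Belief-state observation model
`Pr_P(v,o|b,u) = Σ_{s'} Z(s',u,o) Σ_s T(s,u,v,s') P(s,v) b(s)`. -/
def obsPr [Fintype S] (T : S → U → V → S → ℝ) (Z : S → U → O → ℝ)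
    (P : S → V → ℝ) (b : S → ℝ) (u : U) (v : V) (o : O) : ℝ :=
  ∑ s', Z s' u o * ∑ s, T s u v s' * P s v * b s

/-- Unnormalized belief update
`F_P(b,u,v,o)(s') = Z(s',u,o) Σ_s T(s,u,v,s') P(s,v) b(s)`. -/
def unnormUpd [Fintype S] (T : S → U → V → S → ℝ) (Z : S → U → O → ℝ)
    (P : S → V → ℝ) (b : S → ℝ) (u : U) (v : V) (o : O) (s' : S) : ℝ :=
  Z s' u o * ∑ s, T s u v s' * P s v * b s

/-- Normalized belief update `B_P(b,u,v,o)`. -/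
def beliefUpd [Fintype S] (T : S → U → V → S → ℝ) (Z : S → U → O → ℝ)
    (P : S → V → ℝ) (b : S → ℝ) (u : U) (v : V) (o : O) (s' : S) : ℝ :=
  unnormUpd T Z P b u v o s' / obsPr T Z P b u v o

/-- Value function of I-POMDP Lite: `V^P_0(b) = 0` and
`V^P_{n+1}(b) = max_u [ R_P(b,u) + φ Σ_{v,o} Pr_P(v,o|b,u) V^P_n(B_P(b,u,v,o)) ]`
(summands with `Pr_P(v,o|b,u) = 0` vanish since they are multiplied by `0`). -/
def valFun [Fintype S] [Fintype U] [Fintype V] [Fintype O] [Nonempty U]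
    (T : S → U → V → S → ℝ) (Z : S → U → O → ℝ) (R : S → U → V → ℝ)
    (P : S → V → ℝ) (φ : ℝ) : ℕ → (S → ℝ) → ℝ
  | 0, _ => 0
  | n + 1, b => ⨆ u : U, (expR R P b u +
      φ * ∑ v, ∑ o, obsPr T Z P b u v o * valFun T Z R P φ n (beliefUpd T Z P b u v o))

/-- Q-function of I-POMDP Lite: `qFun … n` is `Q^P_{n+1}`, i.e.
`Q^P_{n+1}(b,u) = R_P(b,u) + φ Σ_{v,o} Pr_P(v,o|b,u) V^P_n(B_P(b,u,v,o))`,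
so that `V^P_{n+1}(b) = max_u (qFun … n b u)`. -/
def qFun [Fintype S] [Fintype U] [Fintype V] [Fintype O] [Nonempty U]
    (T : S → U → V → S → ℝ) (Z : S → U → O → ℝ) (R : S → U → V → ℝ)
    (P : S → V → ℝ) (φ : ℝ) (n : ℕ) (b : S → ℝ) (u : U) : ℝ :=
  expR R P b u +
    φ * ∑ v, ∑ o, obsPr T Z P b u v o * valFun T Z R P φ n (beliefUpd T Z P b u v o)

/-- Prediction error `ε_p = max_{s,v} |Pr*(s,v) − Pr(s,v)|`. -/
def predErr [Fintype S] [Fintype V] [Nonempty S] [Nonempty V]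
    (Pstar Ppred : S → V → ℝ) : ℝ :=
  ⨆ s : S, ⨆ v : V, |Pstar s v - Ppred s v|

/-- Expected total reward of executing the (greedy) policy `π` under the true
strategy `Pstar`: `J_0(b) = 0` and
`J_{k+1}(b) = R_{P*}(b,π_{k+1}(b)) + φ Σ_{v,o} Pr_{P*}(v,o|b,π_{k+1}(b)) J_k(B_{P*}(b,π_{k+1}(b),v,o))`. -/
def execJ [Fintype S] [Fintype V] [Fintype O]
    (T : S → U → V → S → ℝ) (Z : S → U → O → ℝ) (R : S → U → V → ℝ)
    (Pstar : S → V → ℝ) (φ : ℝ) (π : ℕ → (S → ℝ) → U) : ℕ → (S → ℝ) → ℝ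
  | 0, _ => 0
  | k + 1, b =>
      expR R Pstar b (π (k + 1) b) +
        φ * ∑ v, ∑ o, obsPr T Z Pstar b (π (k + 1) b) v o *
          execJ T Z R Pstar φ π k (beliefUpd T Z Pstar b (π (k + 1) b) v o)

/-- Propagating a (signed) weight on `S × V` through the transition and observation kernels
preserves its total mass. -/
lemma sum_kernel [Fintype S] [Fintype V] [Fintype O]
    {T : S → U → V → S → ℝ} {Z : S → U → O → ℝ}
    (hT1 : ∀ s u v, ∑ s', T s u v s' = 1) (hZ1 : ∀ s' u, ∑ o, Z s' u o = 1)
    (u : U) (w : S → V → ℝ) :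
    ∑ v, ∑ o, ∑ s', Z s' u o * ∑ s, T s u v s' * w s v = ∑ s, ∑ v, w s v := by
  rw [Finset.sum_comm (f := w)]
  refine Finset.sum_congr rfl fun v _ => ?_
  rw [Finset.sum_comm]
  simp_rw [← Finset.sum_mul, hZ1, one_mul]
  rw [Finset.sum_comm]
  simp_rw [← Finset.sum_mul, hT1, one_mul]

lemma sum_abs_kernel_le [Fintype S] [Fintype V] [Fintype O]
    {T : S → U → V → S → ℝ} {Z : S → U → O → ℝ}
    (hT0 : ∀ s u v s', 0 ≤ T s u v s') (hT1 : ∀ s u v, ∑ s', T s u v s' = 1)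
    (hZ0 : ∀ s' u o, 0 ≤ Z s' u o) (hZ1 : ∀ s' u, ∑ o, Z s' u o = 1)
    (u : U) (w : S → V → ℝ) :
    ∑ v, ∑ o, ∑ s', |Z s' u o * ∑ s, T s u v s' * w s v| ≤ ∑ s, ∑ v, |w s v| := by
  rw [← sum_kernel hT1 hZ1 u fun s v => |w s v|]
  refine Finset.sum_le_sum fun v _ => Finset.sum_le_sum fun o _ => Finset.sum_le_sum fun s' _ => ?_
  rw [abs_mul, abs_of_nonneg (hZ0 s' u o)]
  refine mul_le_mul_of_nonneg_left ((Finset.abs_sum_le_sum_abs _ _).trans_eq ?_) (hZ0 s' u o)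
  exact Finset.sum_congr rfl fun s _ => by rw [abs_mul, abs_of_nonneg (hT0 s u v s')]

lemma abs_iSup_sub_iSup_le [Finite U] [Nonempty U] {f g : U → ℝ} {C : ℝ}
    (h : ∀ u, |f u - g u| ≤ C) : |(⨆ u, f u) - ⨆ u, g u| ≤ C := by
  have key : ∀ {f g : U → ℝ}, (∀ u, |f u - g u| ≤ C) → (⨆ u, f u) ≤ (⨆ u, g u) + C :=
    fun {f g} h => ciSup_le fun u => by
      have h1 := le_ciSup (Set.finite_range g).bddAbove u
      have h2 := (abs_le.1 (h u)).2
      linarith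
  have h1 := key h
  have h2 := key (f := g) (g := f) fun u => by rw [abs_sub_comm]; exact h u
  exact abs_le.2 ⟨by linarith, by linarith⟩

lemma obsPr_smul [Fintype S] (T : S → U → V → S → ℝ) (Z : S → U → O → ℝ) (P : S → V → ℝ)
    (c : ℝ) (b : S → ℝ) (u : U) (v : V) (o : O) :
    obsPr T Z P (c • b) u v o = c * obsPr T Z P b u v o := by
  simp only [obsPr, Pi.smul_apply, smul_eq_mul, Finset.mul_sum]
  exact Finset.sum_congr rfl fun _ _ => Finset.sum_congr rfl fun _ _ => by ring

lemma beliefUpd_smul [Fintype S] (T : S → U → V → S → ℝ) (Z : S → U → O → ℝ) (P : S → V → ℝ)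
    {c : ℝ} (hc : c ≠ 0) (b : S → ℝ) (u : U) (v : V) (o : O) :
    beliefUpd T Z P (c • b) u v o = beliefUpd T Z P b u v o := by
  funext s'
  have : unnormUpd T Z P (c • b) u v o s' = c * unnormUpd T Z P b u v o s' := by
    simp only [unnormUpd, Pi.smul_apply, smul_eq_mul, Finset.mul_sum]
    exact Finset.sum_congr rfl fun _ _ => by ring
  rw [beliefUpd, beliefUpd, this, obsPr_smul, mul_div_mul_left _ _ hc]

lemma expR_smul [Fintype S] [Fintype V] (R : S → U → V → ℝ) (P : S → V → ℝ) (c : ℝ) (b : S → ℝ) (u : U) :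
    expR R P (c • b) u = c * expR R P b u := by
  simp only [expR, Pi.smul_apply, smul_eq_mul, Finset.mul_sum]
  exact Finset.sum_congr rfl fun _ _ => Finset.sum_congr rfl fun _ _ => by ring

/-- The value function is positively homogeneous. -/
lemma valFun_smul
    [Fintype S] [Fintype U] [Fintype V] [Fintype O] [Nonempty U]
    (T : S → U → V → S → ℝ) (Z : S → U → O → ℝ) (R : S → U → V → ℝ)
    (P : S → V → ℝ) (φ : ℝ) (n : ℕ) {c : ℝ} (hc : 0 ≤ c) (b : S → ℝ) :
    valFun T Z R P φ n (c • b) = c * valFun T Z R P φ n b := by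
  cases n with
  | zero => simp [valFun]
  | succ n =>
    rw [valFun, valFun, Real.mul_iSup_of_nonneg hc]
    refine iSup_congr fun u => ?_
    simp only [expR_smul, obsPr_smul]
    rcases eq_or_ne c 0 with rfl | hc0
    · simp
    simp only [beliefUpd_smul T Z P hc0, mul_assoc, ← Finset.mul_sum]
    ring

lemma unnormUpd_nonneg [Fintype S] {T : S → U → V → S → ℝ} {Z : S → U → O → ℝ} {P : S → V → ℝ}
    (hT0 : ∀ s u v s', 0 ≤ T s u v s') (hZ0 : ∀ s' u o, 0 ≤ Z s' u o) (hP : ∀ s v, 0 ≤ P s v)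
    {x : S → ℝ} (hx : ∀ s, 0 ≤ x s) (u : U) (v : V) (o : O) (s' : S) :
    0 ≤ unnormUpd T Z P x u v o s' :=
  mul_nonneg (hZ0 _ _ _) <| Finset.sum_nonneg fun s _ =>
    mul_nonneg (mul_nonneg (hT0 _ _ _ _) (hP _ _)) (hx s)

lemma obsPr_mul_valFun_beliefUpd
    [Fintype S] [Fintype U] [Fintype V] [Fintype O] [Nonempty U]
    {T : S → U → V → S → ℝ} {Z : S → U → O → ℝ} {P : S → V → ℝ}
    (hT0 : ∀ s u v s', 0 ≤ T s u v s') (hZ0 : ∀ s' u o, 0 ≤ Z s' u o) (hP : ∀ s v, 0 ≤ P s v)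
    (R : S → U → V → ℝ) (φ : ℝ) (n : ℕ)
    {x : S → ℝ} (hx : ∀ s, 0 ≤ x s) (u : U) (v : V) (o : O) :
    obsPr T Z P x u v o * valFun T Z R P φ n (beliefUpd T Z P x u v o) =
      valFun T Z R P φ n (unnormUpd T Z P x u v o) := by
  have h0 := unnormUpd_nonneg hT0 hZ0 hP hx u v o
  have hsum : obsPr T Z P x u v o = ∑ s', unnormUpd T Z P x u v o s' := rfl
  rw [← valFun_smul _ _ _ _ _ _ (hsum ▸ Finset.sum_nonneg fun s' _ => h0 s')]
  congr 1
  funext s'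
  simp only [Pi.smul_apply, smul_eq_mul, beliefUpd]
  refine mul_div_cancel_of_imp' fun h => ?_
  rw [hsum, Finset.sum_eq_zero_iff_of_nonneg fun s' _ => h0 s'] at h
  exact h s' (Finset.mem_univ s')

/-- The `ℓ¹` distance between the joint state-action weights `x ⊗ P` and `y ⊗ Q`. -/
lemma sum_abs_joint_sub_le [Fintype S] [Fintype V] {P Q : S → V → ℝ} {ε : ℝ}
    (hQ : IsStrategy Q) (hPQ : ∀ s v, |P s v - Q s v| ≤ ε)
    {x : S → ℝ} (hx : ∀ s, 0 ≤ x s) (y : S → ℝ) :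
    ∑ s, ∑ v, |P s v * x s - Q s v * y s| ≤
      ∑ s, |x s - y s| + ε * Fintype.card V * ∑ s, x s := by
  rw [Finset.mul_sum, ← Finset.sum_add_distrib]
  refine Finset.sum_le_sum fun s _ => ?_
  calc ∑ v, |P s v * x s - Q s v * y s|
      ≤ ∑ v, (Q s v * |x s - y s| + ε * x s) := by
        refine Finset.sum_le_sum fun v _ => ?_
        have : P s v * x s - Q s v * y s = Q s v * (x s - y s) + (P s v - Q s v) * x s := by ring
        rw [this]
        refine (abs_add_le _ _).trans (add_le_add ?_ ?_)
        · rw [abs_mul, abs_of_nonneg (hQ.1 s v)]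
        · rw [abs_mul, abs_of_nonneg (hx s)]
          exact mul_le_mul_of_nonneg_right (hPQ s v) (hx s)
    _ = |x s - y s| + ε * Fintype.card V * x s := by
        rw [Finset.sum_add_distrib, ← Finset.sum_mul, hQ.2 s]
        simp
        ring

/-- Joint sensitivity of the value function to the (unnormalized) belief and the strategy. -/
lemma abs_valFun_sub_valFun_le
    [Fintype S] [Fintype U] [Fintype V] [Fintype O] [Nonempty U]
    {T : S → U → V → S → ℝ} {Z : S → U → O → ℝ} {R : S → U → V → ℝ}
    {P Q : S → V → ℝ} {φ Rmax ε : ℝ}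
    (hT0 : ∀ s u v s', 0 ≤ T s u v s') (hT1 : ∀ s u v, ∑ s', T s u v s' = 1)
    (hZ0 : ∀ s' u o, 0 ≤ Z s' u o) (hZ1 : ∀ s' u, ∑ o, Z s' u o = 1)
    (hR : ∀ s u v, |R s u v| ≤ Rmax) (hRmax : 0 ≤ Rmax) (hε : 0 ≤ ε)
    (hφ0 : 0 ≤ φ) (hφ1 : φ < 1) (hP : IsStrategy P) (hQ : IsStrategy Q)
    (hPQ : ∀ s v, |P s v - Q s v| ≤ ε) (n : ℕ) {x y : S → ℝ}
    (hx : ∀ s, 0 ≤ x s) (hy : ∀ s, 0 ≤ y s) :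
    |valFun T Z R P φ n x - valFun T Z R Q φ n y| ≤
      Rmax / (1 - φ) * ∑ s, |x s - y s| +
        Rmax / (1 - φ) ^ 2 * (ε * Fintype.card V) * ∑ s, x s := by
  have hφ : 0 < 1 - φ := sub_pos.2 hφ1
  induction n generalizing x y with
  | zero =>
    have h1 : 0 ≤ ∑ s, |x s - y s| := Finset.sum_nonneg fun s _ => abs_nonneg _
    have h2 : 0 ≤ ∑ s, x s := Finset.sum_nonneg fun s _ => hx s
    simp only [valFun, sub_zero, abs_zero]
    positivity
  | succ n ih =>
    refine abs_iSup_sub_iSup_le fun u => ?_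
    set d := ∑ s, ∑ v, |P s v * x s - Q s v * y s| with hd
    have hdle : d ≤ ∑ s, |x s - y s| + ε * Fintype.card V * ∑ s, x s :=
      sum_abs_joint_sub_le hQ hPQ hx y
    have hreward : |expR R P x u - expR R Q y u| ≤ Rmax * d := by
      simp only [expR, ← Finset.sum_sub_distrib, hd, Finset.mul_sum]
      refine (Finset.abs_sum_le_sum_abs _ _).trans (Finset.sum_le_sum fun s _ =>
        (Finset.abs_sum_le_sum_abs _ _).trans (Finset.sum_le_sum fun v _ => ?_))
      have : x s * P s v * R s u v - y s * Q s v * R s u v =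
          R s u v * (P s v * x s - Q s v * y s) := by ring
      rw [this, abs_mul]
      exact mul_le_mul_of_nonneg_right (hR s u v) (abs_nonneg _)
    have hdist : ∑ v, ∑ o, ∑ s', |unnormUpd T Z P x u v o s' - unnormUpd T Z Q y u v o s'| ≤ d := by
      refine le_trans (le_of_eq ?_) (sum_abs_kernel_le hT0 hT1 hZ0 hZ1 u _)
      simp only [unnormUpd, ← mul_sub, ← Finset.sum_sub_distrib, mul_assoc]
    have hmass : ∑ v, ∑ o, ∑ s', unnormUpd T Z P x u v o s' = ∑ s, x s := by
      simp only [unnormUpd, mul_assoc]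
      rw [sum_kernel hT1 hZ1 u fun s v => P s v * x s]
      simp only [← Finset.sum_mul, hP.2, one_mul]
    have hfuture : |∑ v, ∑ o, valFun T Z R P φ n (unnormUpd T Z P x u v o) -
        ∑ v, ∑ o, valFun T Z R Q φ n (unnormUpd T Z Q y u v o)| ≤
        Rmax / (1 - φ) * d + Rmax / (1 - φ) ^ 2 * (ε * Fintype.card V) * ∑ s, x s := by
      simp only [← Finset.sum_sub_distrib]
      calc _ ≤ ∑ v, ∑ o, (Rmax / (1 - φ) *
                ∑ s', |unnormUpd T Z P x u v o s' - unnormUpd T Z Q y u v o s'| +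
              Rmax / (1 - φ) ^ 2 * (ε * Fintype.card V) * ∑ s', unnormUpd T Z P x u v o s') :=
            (Finset.abs_sum_le_sum_abs _ _).trans (Finset.sum_le_sum fun v _ =>
              (Finset.abs_sum_le_sum_abs _ _).trans (Finset.sum_le_sum fun o _ =>
                ih (unnormUpd_nonneg hT0 hZ0 hP.1 hx u v o)
                  (unnormUpd_nonneg hT0 hZ0 hQ.1 hy u v o)))
        _ ≤ _ := by
            simp only [Finset.sum_add_distrib, ← Finset.mul_sum, hmass]
            gcongr
    simp only [obsPr_mul_valFun_beliefUpd hT0 hZ0 hP.1 R φ n hx,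
      obsPr_mul_valFun_beliefUpd hT0 hZ0 hQ.1 R φ n hy]
    rw [add_sub_add_comm, ← mul_sub]
    refine (abs_add_le _ _).trans ?_
    rw [abs_mul, abs_of_nonneg hφ0]
    calc _ ≤ Rmax * d + φ * (Rmax / (1 - φ) * d +
            Rmax / (1 - φ) ^ 2 * (ε * Fintype.card V) * ∑ s, x s) := by gcongr
      _ = Rmax / (1 - φ) * d +
            φ * (Rmax / (1 - φ) ^ 2 * (ε * Fintype.card V) * ∑ s, x s) := by
          field_simp
          ring
      _ ≤ Rmax / (1 - φ) * (∑ s, |x s - y s| + ε * Fintype.card V * ∑ s, x s) +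
            φ * (Rmax / (1 - φ) ^ 2 * (ε * Fintype.card V) * ∑ s, x s) := by gcongr
      _ = _ := by
          field_simp
          ring

lemma abs_sub_le_predErr [Fintype S] [Fintype V] [Nonempty S] [Nonempty V]
    (P Q : S → V → ℝ) (s : S) (v : V) : |P s v - Q s v| ≤ predErr P Q :=
  (le_ciSup (Set.finite_range fun v => |P s v - Q s v|).bddAbove v).trans
    (le_ciSup (Set.finite_range fun s => ⨆ v, |P s v - Q s v|).bddAbove s)

/-- **Proposition 4:** the error of the optimal value function computed with the
predicted strategy is linearly bounded by the prediction error: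
`δ_n ≤ ε_p |V| R_max [φ^{n−1} + (1/(1−φ))(1 + 3φ|O|/(1−φ))]` for every `n ≥ 1`. -/
theorem ipomdp_lite_value_error_bound
    [Fintype S] [Fintype U] [Fintype V] [Fintype O]
    [Nonempty S] [Nonempty U] [Nonempty V] [Nonempty O]
    (T : S → U → V → S → ℝ) (Z : S → U → O → ℝ) (R : S → U → V → ℝ)
    (Pstar Ppred : S → V → ℝ) (φ : ℝ) (Rmax : ℝ)
    (hT0 : ∀ s u v s', 0 ≤ T s u v s') (hT1 : ∀ s u v, ∑ s', T s u v s' = 1)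
    (hZ0 : ∀ s' u o, 0 ≤ Z s' u o) (hZ1 : ∀ s' u, ∑ o, Z s' u o = 1)
    (hR : ∀ s u v, 0 ≤ R s u v ∧ R s u v ≤ Rmax)
    (hφ0 : 0 < φ) (hφ1 : φ < 1)
    (hPstar : IsStrategy Pstar) (hPpred : IsStrategy Ppred)
    (n : ℕ) (hn : 1 ≤ n) :
    ∀ b : S → ℝ, IsBelief b →
      |valFun T Z R Pstar φ n b - valFun T Z R Ppred φ n b| ≤
        predErr Pstar Ppred * (Fintype.card V) * Rmax *
          (φ ^ (n - 1) + (1 / (1 - φ)) * (1 + 3 * φ * (Fintype.card O) / (1 - φ))) := by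
  intro b hb
  have hφ : 0 < 1 - φ := sub_pos.2 hφ1
  let s₀ := Classical.arbitrary S
  let u₀ := Classical.arbitrary U
  let v₀ := Classical.arbitrary V
  have hRmax : 0 ≤ Rmax := (hR s₀ u₀ v₀).1.trans (hR s₀ u₀ v₀).2
  have hε : 0 ≤ predErr Pstar Ppred :=
    (abs_nonneg _).trans (abs_sub_le_predErr Pstar Ppred s₀ v₀)
  have hO : (1 : ℝ) ≤ Fintype.card O := by exact_mod_cast Fintype.card_pos
  have h := abs_valFun_sub_valFun_le hT0 hT1 hZ0 hZ1
    (fun s u v => abs_le.2 ⟨by linarith [(hR s u v).1], (hR s u v).2⟩) hRmax hε hφ0.le hφ1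
    hPstar hPpred (abs_sub_le_predErr Pstar Ppred) n hb.1 hb.1
  simp only [sub_self, abs_zero, Finset.sum_const_zero, mul_zero, zero_add, hb.2, mul_one] at h
  refine h.trans ?_
  have hconst : 1 / (1 - φ) ^ 2 ≤
      φ ^ (n - 1) + (1 / (1 - φ)) * (1 + 3 * φ * (Fintype.card O) / (1 - φ)) := by
    have hsq : 1 / (1 - φ) ^ 2 = (1 / (1 - φ)) * (1 + φ / (1 - φ)) := by
      field_simp
      ring
    have hle : φ ≤ 3 * φ * Fintype.card O := by nlinarith
    rw [hsq]
    refine le_add_of_nonneg_of_le (by positivity) ?_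
    gcongr
  calc _ = predErr Pstar Ppred * (Fintype.card V) * Rmax * (1 / (1 - φ) ^ 2) := by ring
    _ ≤ _ := by gcongr
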